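/- There exists a constant C > 0 such that for all integers n ≥ 1 and all real t ≥ 1, the probability that n·|V(X_n; 𝒳_n)| exceeds t is at most C·exp(−t/C); that is, the rescaled Lebesgue measure of the Voronoi cell of a typical point among n i.i.d. points has an exponentially decaying tail, uniformly in n. (Lemma 5.1 of the paper.) -/

import Mathlib

open MeasureTheory ProbabilityTheory Filter Topology
open scoped RealInnerProductSpace

noncomputable section

/-- Euclidean space `ℝ^d`. -/
abbrev EucSp (d : ℕ) := EuclideanSpace ℝ (Fin d)

/-- The closed Voronoi cell of `x` relative to the point set `S`:
all points at least as close to `x` as to any point of `S`. -/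
def vorCell {d : ℕ} (x : EucSp d) (S : Set (EucSp d)) : Set (EucSp d) :=
  {y | ∀ z ∈ S, dist y x ≤ dist y z}

/-- The open unit cube `(0,1)^d`. -/
def unitCube (d : ℕ) : Set (EucSp d) := {x | ∀ i, x i ∈ Set.Ioo (0 : ℝ) 1}

/-- The sample set `𝒳_n = {X_0, …, X_{n-1}}` at outcome `ω`. -/
def sample {d : ℕ} {Ωp : Type*} (X : ℕ → Ωp → EucSp d) (n : ℕ) (ω : Ωp) :
    Set (EucSp d) :=
  (fun i => X i ω) '' Set.Iio n

/-- The Voronoi estimator `A_n = ⋃_{x ∈ 𝒳_n ∩ A} (Ṽ(x;𝒳_n) ∩ Ω)`. -/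
def vorEst {d : ℕ} {Ωp : Type*} (X : ℕ → Ωp → EucSp d) (A : Set (EucSp d))
    (n : ℕ) (ω : Ωp) : Set (EucSp d) :=
  ⋃ i ∈ Set.Iio n, ⋃ (_ : X i ω ∈ A), vorCell (X i ω) (sample X n ω) ∩ unitCube d


/-- An open cone around direction `u`. -/
def coneSet {d : ℕ} (u : EucSp d) : Set (EucSp d) := {v | ‖v - ‖v‖ • u‖ < ‖v‖ / 2}

lemma coneSet_key {d : ℕ} {u y z : EucSp d} (hy : y ∈ coneSet u) (hz : z ∈ coneSet u)
    (h : ‖z‖ ≤ ‖y‖) : ‖y - z‖ < ‖y‖ := by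
  simp only [coneSet, Set.mem_ofPred_eq] at hy hz
  have hz0 : 0 < ‖z‖ := by
    have := norm_nonneg (z - ‖z‖ • u); linarith
  have hy0 : 0 < ‖y‖ := by linarith
  set r := ‖y‖ with hr
  set s := ‖z‖ with hs
  have e : y - z = (1 - s / r) • y + ((s / r) • (y - r • u) - (z - s • u)) := by
    rw [smul_sub, smul_smul, div_mul_cancel₀ _ hy0.ne', sub_smul, one_smul]
    abel
  have hsr : s / r ≤ 1 := by rw [div_le_one hy0]; exact h
  have hsr0 : 0 < s / r := by positivity
  have h1 : ‖(1 - s / r) • y‖ = r - s := by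
    rw [norm_smul, Real.norm_of_nonneg (by linarith), ← hr]
    field_simp
  have h2 : ‖(s / r) • (y - r • u)‖ < s / 2 := by
    rw [norm_smul, Real.norm_of_nonneg hsr0.le]
    calc s / r * ‖y - r • u‖ < s / r * (r / 2) := by gcongr
      _ = s / 2 := by field_simp
  calc ‖y - z‖ ≤ ‖(1 - s / r) • y‖ + ‖(s / r) • (y - r • u) - (z - s • u)‖ := by
        rw [e]; exact norm_add_le _ _
    _ ≤ (r - s) + (‖(s / r) • (y - r • u)‖ + ‖z - s • u‖) := by
        rw [h1]; gcongr; exact norm_sub_le _ _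
    _ < r := by linarith

lemma coneSet_ne {d : ℕ} {u : EucSp d} : (0 : EucSp d) ∉ coneSet u := by
  simp [coneSet]

lemma coneSet_meas {d : ℕ} (u : EucSp d) : MeasurableSet (coneSet u) := by
  apply IsOpen.measurableSet
  exact isOpen_lt (by fun_prop) (by fun_prop)

lemma coneSet_cover (d : ℕ) : ∃ T : Finset (EucSp d), ∀ v : EucSp d, v ≠ 0 →
    ∃ u ∈ T, v ∈ coneSet u := by
  obtain ⟨t, -, hf, hc⟩ := (isCompact_sphere (0 : EucSp d) 1).finite_cover_balls
    (e := 1 / 2) (by norm_num)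
  refine ⟨hf.toFinset, fun v hv => ?_⟩
  have hv0 : 0 < ‖v‖ := norm_pos_iff.2 hv
  have hm : ‖v‖⁻¹ • v ∈ Metric.sphere (0 : EucSp d) 1 := by
    simp [norm_smul, hv0.ne']
  obtain ⟨u, hu, hb⟩ := Set.mem_iUnion₂.1 (hc hm)
  refine ⟨u, by simpa using hu, ?_⟩
  rw [mem_ball_iff_norm] at hb
  have e : v - ‖v‖ • u = ‖v‖ • (‖v‖⁻¹ • v - u) := by
    rw [smul_sub, smul_smul, mul_inv_cancel₀ hv0.ne', one_smul]
  show ‖v - ‖v‖ • u‖ < ‖v‖ / 2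
  rw [e, norm_smul, norm_norm]
  nlinarith

lemma unitCube_meas (d : ℕ) : MeasurableSet (unitCube d) := by
  have : unitCube d = ⋂ i, {x : EucSp d | x i ∈ Set.Ioo (0 : ℝ) 1} := by
    ext x; simp [unitCube]
  rw [this]
  refine MeasurableSet.iInter fun i => ?_
  exact measurableSet_Ioo.preimage (by fun_prop)

lemma unitCube_vol (d : ℕ) : volume (unitCube d) = 1 := by
  have h := (PiLp.volume_preserving_ofLp (Fin d)).measure_preimage
    (s := Set.univ.pi fun _ => Set.Ioo (0 : ℝ) 1)
    (MeasurableSet.univ_pi fun _ => measurableSet_Ioo).nullMeasurableSet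
  have e : unitCube d = WithLp.ofLp ⁻¹' (Set.univ.pi fun _ => Set.Ioo (0 : ℝ) 1) := by
    ext x; simp [unitCube]
  rw [e, h, volume_pi_pi]
  simp

lemma low_part {d : ℕ} (hd : 1 ≤ d) (x : EucSp d) (A : Set (EucSp d)) (hA : MeasurableSet A)
    (hfin : volume A ≠ ⊤) (s : ENNReal) (hs : s < volume A) :
    s ≤ volume {z ∈ A | volume {u ∈ A | dist u x ≤ dist z x} ≤ s} := by
  have : Nonempty (Fin d) := ⟨⟨0, hd⟩⟩
  set w : ℝ → ENNReal := fun r => volume (Metric.closedBall x r ∩ A) with hw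
  have hwe : ∀ z, volume {u ∈ A | dist u x ≤ dist z x} = w (dist z x) := by
    intro z; congr 1; ext u; simp [and_comm]
  simp only [hwe]
  have hmono : Monotone w := fun a b hab =>
    measure_mono (Set.inter_subset_inter_left _ (Metric.closedBall_subset_closedBall hab))
  by_cases hR : ∃ r, s < w r
  · set R : Set ℝ := {r | s < w r} with hRdef
    have hbdd : BddBelow R := by
      refine ⟨0, fun r hr => ?_⟩
      by_contra hneg
      have : Metric.closedBall x r = ∅ := Metric.closedBall_eq_empty.2 (not_le.1 hneg)
      simp [hRdef, hw, this] at hr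
    set r₀ := sInf R with hr₀
    have hgt : ∀ r > r₀, s < w r := by
      intro r hr
      obtain ⟨r', hr', hlt⟩ := exists_lt_of_csInf_lt hR hr
      exact lt_of_lt_of_le hr' (hmono hlt.le)
    have hlim := tendsto_measure_biInter_gt (μ := (volume : Measure (EucSp d)))
      (s := fun r => Metric.closedBall x r ∩ A) (a := r₀)
      (fun r _ => (Metric.isClosed_closedBall.measurableSet.inter hA).nullMeasurableSet)
      (fun i j _ hij => Set.inter_subset_inter_left _ (Metric.closedBall_subset_closedBall hij))
      ⟨r₀ + 1, by simp, measure_ne_top_of_subset Set.inter_subset_right hfin⟩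
    have hinter : (⋂ r, ⋂ (_ : r > r₀), Metric.closedBall x r ∩ A) ⊆ Metric.closedBall x r₀ ∩ A := by
      intro y hy
      simp only [Set.mem_iInter, Set.mem_inter_iff, Metric.mem_closedBall] at hy ⊢
      exact ⟨le_of_forall_gt_imp_ge_of_dense fun r hr => (hy r hr).1, (hy (r₀ + 1) (by simp)).2⟩
    have h1 : s ≤ volume (Metric.closedBall x r₀ ∩ A) := by
      refine le_trans (ge_of_tendsto hlim ?_) (measure_mono hinter)
      filter_upwards [self_mem_nhdsWithin] with r hr
      exact (hgt r hr).le
    have h2 : volume (Metric.closedBall x r₀ ∩ A) ≤ volume (Metric.ball x r₀ ∩ A) := by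
      calc volume (Metric.closedBall x r₀ ∩ A)
          ≤ volume ((Metric.ball x r₀ ∩ A) ∪ Metric.sphere x r₀) := by
            apply measure_mono
            rw [← Metric.ball_union_sphere]
            rintro y ⟨hy | hy, hyA⟩
            · exact Or.inl ⟨hy, hyA⟩
            · exact Or.inr hy
        _ ≤ _ := measure_union_le _ _
        _ = _ := by rw [Measure.addHaar_sphere, add_zero]
    refine h1.trans (h2.trans (measure_mono ?_))
    rintro z ⟨hz, hzA⟩
    refine ⟨hzA, ?_⟩
    by_contra hcon
    have : r₀ ≤ dist z x := csInf_le hbdd (not_le.1 hcon)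
    exact absurd (Metric.mem_ball.1 hz) (not_lt.2 this)
  · push Not at hR
    have : {z | z ∈ A ∧ w (dist z x) ≤ s} = A := by
      ext z; simp [hR]
    rw [this]; exact hs.le

/-- The part of the cube in the cone at `x`. -/
def coneAt {d : ℕ} (u x : EucSp d) : Set (EucSp d) := {y | y - x ∈ coneSet u ∧ y ∈ unitCube d}

def badSet {d : ℕ} (u : EucSp d) (s : ENNReal) (x : EucSp d) : Set (EucSp d) :=
  {z ∈ coneAt u x | volume {y ∈ coneAt u x | dist y x ≤ dist z x} ≤ s}

lemma coneAt_meas2 {d : ℕ} (u : EucSp d) {α : Type*} [MeasurableSpace α]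
    {f g : α → EucSp d} (hf : Measurable f) (hg : Measurable g) :
    MeasurableSet {p : α | f p ∈ coneAt u (g p)} :=
  ((coneSet_meas u).preimage (hf.sub hg)).inter ((unitCube_meas d).preimage hf)

lemma coneAt_meas {d : ℕ} (u x : EucSp d) : MeasurableSet (coneAt u x) :=
  coneAt_meas2 u measurable_id measurable_const

lemma badSet_meas {d : ℕ} (u : EucSp d) (s : ENNReal) :
    MeasurableSet {p : EucSp d × EucSp d | p.2 ∈ badSet u s p.1} := by
  refine (coneAt_meas2 u measurable_snd measurable_fst).inter ?_
  have h : MeasurableSet {q : (EucSp d × EucSp d) × EucSp d |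
      q.2 ∈ coneAt u q.1.1 ∧ dist q.2 q.1.1 ≤ dist q.1.2 q.1.1} := by
    refine (coneAt_meas2 u measurable_snd (measurable_fst.comp measurable_fst)).inter ?_
    exact measurableSet_le (f := fun q : (EucSp d × EucSp d) × EucSp d => dist q.2 q.1.1)
      (g := fun q => dist q.1.2 q.1.1) (by fun_prop) (by fun_prop)
  have h2 := measurable_measure_prodMk_left (ν := (volume : Measure (EucSp d))) h
  exact measurableSet_le h2 measurable_const

lemma total_meas {d : ℕ} (u : EucSp d) (s : ENNReal) :
    MeasurableSet {x : EucSp d | s < volume (coneAt u x)} := by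
  have h : MeasurableSet {q : EucSp d × EucSp d | q.2 ∈ coneAt u q.1} :=
    coneAt_meas2 u measurable_snd measurable_fst
  have h2 := measurable_measure_prodMk_left (ν := (volume : Measure (EucSp d))) h
  exact measurableSet_lt measurable_const h2

lemma law_lower {d : ℕ} (κ : EucSp d → ℝ) {c : ℝ}
    (hc : ∀ x ∈ unitCube d, c ≤ κ x) (B : Set (EucSp d)) (hB : MeasurableSet B)
    (hBc : B ⊆ unitCube d) :
    ENNReal.ofReal c * volume B ≤ (volume.withDensity fun x => ENNReal.ofReal (κ x)) B := by
  rw [withDensity_apply _ hB, ← setLIntegral_const]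
  exact setLIntegral_mono' hB fun x hx => ENNReal.ofReal_le_ofReal (hc x (hBc hx))

lemma cone_prob {d : ℕ} (hd : 1 ≤ d)
    {Ωp : Type*} [MeasureSpace Ωp] [IsProbabilityMeasure (ℙ : Measure Ωp)]
    (κ : EucSp d → ℝ) {c : ℝ} (hc0 : 0 < c)
    (hc : ∀ x ∈ unitCube d, c ≤ κ x)
    (X : ℕ → Ωp → EucSp d) (hXmeas : ∀ i, Measurable (X i))
    (hiid : iIndepFun X ℙ)
    (hlaw : ∀ i, Measure.map (X i) ℙ
      = volume.withDensity fun x => ENNReal.ofReal (κ x)) (u : EucSp d) (m : ℕ) (s : ℝ)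
    (hs : 0 ≤ s) :
    ℙ {ω | ENNReal.ofReal s < volume (coneAt u (X m ω)) ∧
      ∀ i : Fin m, X i ω ∉ badSet u (ENNReal.ofReal s) (X m ω)}
      ≤ ENNReal.ofReal (Real.exp (-(c * s) * m)) := by
  have hprob : IsProbabilityMeasure (volume.withDensity fun x => ENNReal.ofReal (κ x)) := by
    rw [← hlaw 0]; exact Measure.isProbabilityMeasure_map (hXmeas 0).aemeasurable
  set μ := (volume.withDensity fun x => ENNReal.ofReal (κ x)) with hμ
  set Y : Ωp → (Fin m → EucSp d) := fun ω i => X i ω with hY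
  have hYm : Measurable Y := measurable_pi_lambda _ fun i => hXmeas i
  have hind : IndepFun (X m) Y ℙ := by
    have h := hiid.indepFun_finset {m} (Finset.range m) (by simp) hXmeas
    have h1 : Measurable (fun (f : ({m} : Finset ℕ) → EucSp d) => f ⟨m, by simp⟩) := by
      fun_prop
    have h2 : Measurable (fun (f : (Finset.range m) → EucSp d) (i : Fin m) =>
        f ⟨i, by simp⟩) := by fun_prop
    exact h.comp h1 h2
  have hYlaw : Measure.map Y ℙ = Measure.pi fun _ => μ := by
    have h := (iIndepFun_iff_map_fun_eq_pi_map (fun i : Fin m => (hXmeas i).aemeasurable)).1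
      (hiid.precomp (g := fun i : Fin m => (i : ℕ)) Fin.val_injective)
    simp only [hlaw] at h
    exact h
  have hjoint := (indepFun_iff_map_prod_eq_prod_map_map (hXmeas m).aemeasurable
    hYm.aemeasurable).1 hind
  rw [hYlaw, hlaw] at hjoint
  set G : Set (EucSp d × (Fin m → EucSp d)) := {p | ENNReal.ofReal s < volume (coneAt u p.1) ∧
    ∀ i : Fin m, p.2 i ∉ badSet u (ENNReal.ofReal s) p.1} with hG
  have hGm : MeasurableSet G := by
    refine ((total_meas u _).preimage measurable_fst).inter ?_
    have : {p : EucSp d × (Fin m → EucSp d) | ∀ i : Fin m,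
        p.2 i ∉ badSet u (ENNReal.ofReal s) p.1} =
        ⋂ i : Fin m, {p | p.2 i ∉ badSet u (ENNReal.ofReal s) p.1} := by
      ext; simp
    rw [Set.ext_iff] at this
    have h3 : MeasurableSet (⋂ i : Fin m, {p : EucSp d × (Fin m → EucSp d) |
        p.2 i ∉ badSet u (ENNReal.ofReal s) p.1}) := by
      refine MeasurableSet.iInter fun i => MeasurableSet.compl ?_
      exact (badSet_meas u (ENNReal.ofReal s)).preimage
        (f := fun p : EucSp d × (Fin m → EucSp d) => (p.1, p.2 i)) (by fun_prop)
    rwa [← Set.ext this] at h3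
  have e : {ω | ENNReal.ofReal s < volume (coneAt u (X m ω)) ∧
      ∀ i : Fin m, X i ω ∉ badSet u (ENNReal.ofReal s) (X m ω)}
      = (fun ω => (X m ω, Y ω)) ⁻¹' G := rfl
  rw [e, ← Measure.map_apply ((hXmeas m).prodMk hYm) hGm, hjoint, Measure.prod_apply hGm]
  have hsec : ∀ x, (Measure.pi fun _ : Fin m => μ) (Prod.mk x ⁻¹' G)
      ≤ ENNReal.ofReal (Real.exp (-(c * s) * m)) := by
    intro x
    by_cases hx : ENNReal.ofReal s < volume (coneAt u x)
    · have e2 : Prod.mk x ⁻¹' G = Set.univ.pi fun _ => (badSet u (ENNReal.ofReal s) x)ᶜ := by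
        ext y; simp [hG, hx]
      have hbm : MeasurableSet (badSet u (ENNReal.ofReal s) x) :=
        (badSet_meas u (ENNReal.ofReal s)).preimage (f := fun z => (x, z)) (by fun_prop)
      have hfin : volume (coneAt u x) ≠ ⊤ :=
        ((measure_mono (fun y hy => hy.2 : coneAt u x ⊆ unitCube d)).trans_lt
          (by simp [unitCube_vol])).ne
      have hlow := low_part hd x (coneAt u x) (coneAt_meas u x) hfin _ hx
      have hμB : ENNReal.ofReal (c * s) ≤ μ (badSet u (ENNReal.ofReal s) x) := by
        rw [ENNReal.ofReal_mul hc0.le]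
        exact (mul_le_mul_right hlow _).trans (law_lower κ hc _ hbm fun y hy => hy.1.2)
      rw [e2, Measure.pi_pi, Finset.prod_const, Finset.card_univ, Fintype.card_fin,
        prob_compl_eq_one_sub hbm]
      have hle : 1 - μ (badSet u (ENNReal.ofReal s) x) ≤ ENNReal.ofReal (Real.exp (-(c * s))) := by
        calc 1 - μ (badSet u (ENNReal.ofReal s) x) ≤ 1 - ENNReal.ofReal (c * s) :=
              tsub_le_tsub_left hμB _
          _ = ENNReal.ofReal (1 - c * s) := by
              rw [ENNReal.ofReal_sub _ (by positivity), ENNReal.ofReal_one]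
          _ ≤ _ := ENNReal.ofReal_le_ofReal (by
              have := Real.add_one_le_exp (-(c * s)); linarith)
      calc _ ≤ ENNReal.ofReal (Real.exp (-(c * s))) ^ m := pow_le_pow_left' hle m
        _ = _ := by
          rw [← ENNReal.ofReal_pow (Real.exp_pos _).le, ← Real.exp_nat_mul, mul_comm]
    · have e2 : Prod.mk x ⁻¹' G = ∅ := by
        ext y; simp [hG, hx]
      simp [e2]
  calc _ ≤ ∫⁻ _, ENNReal.ofReal (Real.exp (-(c * s) * m)) ∂μ := lintegral_mono hsec
    _ = _ := by simp

lemma cell_cover {d : ℕ} (hd : 1 ≤ d) (T : Finset (EucSp d))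
    (hT : ∀ v : EucSp d, v ≠ 0 → ∃ u ∈ T, v ∈ coneSet u) (x : EucSp d) (S : Set (EucSp d)) :
    volume (vorCell x S ∩ unitCube d) ≤ ∑ u ∈ T, volume (vorCell x S ∩ coneAt u x) := by
  have : Nonempty (Fin d) := ⟨⟨0, hd⟩⟩
  calc volume (vorCell x S ∩ unitCube d)
      ≤ volume ({x} ∪ ⋃ u ∈ T, (vorCell x S ∩ coneAt u x)) := by
        apply measure_mono
        rintro y ⟨hy, hyc⟩
        by_cases hxy : y = x
        · exact Or.inl hxy
        · obtain ⟨u, hu, hm⟩ := hT (y - x) (sub_ne_zero.2 hxy)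
          exact Or.inr (Set.mem_iUnion₂.2 ⟨u, hu, hy, hm, hyc⟩)
    _ ≤ volume {x} + volume (⋃ u ∈ T, (vorCell x S ∩ coneAt u x)) := measure_union_le _ _
    _ = volume (⋃ u ∈ T, (vorCell x S ∩ coneAt u x)) := by simp
    _ ≤ _ := measure_biUnion_finset_le _ _

lemma cell_cone {d : ℕ} (u x z : EucSp d) (S : Set (EucSp d)) (hz : z ∈ S) (s : ENNReal)
    (hb : z ∈ badSet u s x) : volume (vorCell x S ∩ coneAt u x) ≤ s := by
  refine (measure_mono ?_).trans hb.2
  rintro y ⟨hy, hyc⟩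
  refine ⟨hyc, ?_⟩
  by_contra hlt
  have hlt := not_le.1 hlt
  have h1 := coneSet_key hyc.1 hb.1.1 (by rw [← dist_eq_norm, ← dist_eq_norm]; exact hlt.le)
  rw [sub_sub_sub_cancel_right, ← dist_eq_norm, ← dist_eq_norm] at h1
  exact absurd (hy z hz) (not_le.2 h1)

/-- **Lemma 5.1.** There is a constant `C` such that for all `n ≥ 1` and `t ≥ 1`,
`P[n·|V(X_n;𝒳_n)| > t] ≤ C e^{−t/C}`. -/
theorem stmt4 {d : ℕ} (hd : 1 ≤ d)
    {Ωp : Type*} [MeasureSpace Ωp] [IsProbabilityMeasure (ℙ : Measure Ωp)]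
    (κ : EucSp d → ℝ) (hκmeas : Measurable κ)
    (hκ0 : ∀ x ∉ unitCube d, κ x = 0)
    (hκpos : ∃ c > 0, ∀ x ∈ unitCube d, c ≤ κ x)
    (X : ℕ → Ωp → EucSp d) (hXmeas : ∀ i, Measurable (X i))
    (hiid : iIndepFun X ℙ)
    (hlaw : ∀ i, Measure.map (X i) ℙ
      = volume.withDensity fun x => ENNReal.ofReal (κ x)) :
    ∃ C > 0, ∀ n : ℕ, 1 ≤ n → ∀ t : ℝ, 1 ≤ t →
      (ℙ {ω | t < (n : ℝ) *
          (volume (vorCell (X (n - 1) ω) (sample X n ω) ∩ unitCube d)).toReal}).toReal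
        ≤ C * Real.exp (-t / C) := by
  obtain ⟨c, hc0, hc⟩ := hκpos
  obtain ⟨T, hT⟩ := coneSet_cover d
  set N : ℝ := (T.card : ℝ) + 1 with hN
  have hNpos : 0 < N := by positivity
  refine ⟨N + 2 * N / c, by positivity, fun n hn t ht => ?_⟩
  set C := N + 2 * N / c with hC
  have hCpos : 0 < C := by positivity
  have hvol : ∀ ω, volume (vorCell (X (n - 1) ω) (sample X n ω) ∩ unitCube d) ≤ 1 := fun ω =>
    (measure_mono Set.inter_subset_right).trans (unitCube_vol d).le
  obtain ⟨m, rfl⟩ : ∃ m, n = m + 1 := ⟨n - 1, by omega⟩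
  rcases Nat.eq_zero_or_pos m with rfl | hm
  · have : {ω | t < ((0 + 1 : ℕ) : ℝ) *
          (volume (vorCell (X (0 + 1 - 1) ω) (sample X (0 + 1) ω) ∩ unitCube d)).toReal} = ∅ := by
      ext ω
      have h := ENNReal.toReal_mono ENNReal.one_ne_top (hvol ω)
      simp only [ENNReal.toReal_one] at h
      simp only [Set.mem_ofPred_eq, Set.mem_empty_iff_false, iff_false, not_lt]
      push_cast
      linarith
    rw [this]
    simp only [measure_empty, ENNReal.toReal_zero]
    positivity
  set s : ℝ := t / ((m + 1) * N) with hs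
  have hs0 : 0 ≤ s := by positivity
  have hsub : {ω | t < ((m + 1 : ℕ) : ℝ) *
      (volume (vorCell (X (m + 1 - 1) ω) (sample X (m + 1) ω) ∩ unitCube d)).toReal}
      ⊆ ⋃ u ∈ T, {ω | ENNReal.ofReal s < volume (coneAt u (X m ω)) ∧
      ∀ i : Fin m, X i ω ∉ badSet u (ENNReal.ofReal s) (X m ω)} := by
    intro ω hω
    simp only [Set.mem_ofPred_eq, Nat.add_sub_cancel] at hω
    by_contra hcon
    simp only [Set.mem_iUnion, not_exists] at hcon
    have hall : ∀ u ∈ T, volume (vorCell (X m ω) (sample X (m + 1) ω) ∩ coneAt u (X m ω))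
        ≤ ENNReal.ofReal s := by
      intro u hu
      by_contra hlt
      refine hcon u hu ⟨(not_le.1 hlt).trans_le (measure_mono Set.inter_subset_right), ?_⟩
      intro i hi
      have hmem : X i ω ∈ sample X (m + 1) ω := ⟨i, by simp, rfl⟩
      exact hlt (cell_cone u _ _ _ hmem _ hi)
    have h1 := (cell_cover hd T hT (X m ω) (sample X (m + 1) ω)).trans (Finset.sum_le_sum hall)
    rw [Finset.sum_const, nsmul_eq_mul] at h1
    have h2 := ENNReal.toReal_mono (by finiteness) h1
    rw [ENNReal.toReal_mul, ENNReal.toReal_natCast, ENNReal.toReal_ofReal hs0] at h2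
    have h3 : (T.card : ℝ) * s ≤ N * s := by rw [hN]; nlinarith
    have h4 : (m + 1 : ℝ) * (N * s) = t := by rw [hs]; field_simp
    push_cast at hω
    have h5 := mul_le_mul_of_nonneg_left (h2.trans h3) (by positivity : (0 : ℝ) ≤ m + 1)
    linarith
  have hP : ℙ {ω | t < ((m + 1 : ℕ) : ℝ) *
      (volume (vorCell (X (m + 1 - 1) ω) (sample X (m + 1) ω) ∩ unitCube d)).toReal}
      ≤ T.card * ENNReal.ofReal (Real.exp (-(c * s) * m)) := by
    refine (measure_mono hsub).trans ((measure_biUnion_finset_le _ _).trans ?_)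
    rw [← nsmul_eq_mul, ← Finset.sum_const]
    exact Finset.sum_le_sum fun u _ => cone_prob hd κ hc0 hc X hXmeas hiid hlaw u m s hs0
  have hP2 := ENNReal.toReal_mono (by finiteness) hP
  rw [ENNReal.toReal_mul, ENNReal.toReal_natCast,
    ENNReal.toReal_ofReal (Real.exp_pos _).le] at hP2
  refine hP2.trans ?_
  have hm1 : (1 : ℝ) ≤ m := by exact_mod_cast hm
  have hNC : (T.card : ℝ) ≤ C := by
    have : 0 < 2 * N / c := by positivity
    rw [hC]; linarith
  have hexp : -(c * s) * m ≤ -t / C := by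
    have hC2 : 2 * N / c ≤ C := by rw [hC]; linarith
    have h1 : t / C ≤ t / (2 * N / c) := by gcongr
    have h2 : t / (2 * N / c) ≤ c * s * m := by
      rw [hs]
      have : c * (t / ((m + 1) * N)) * m = (t * c / N) * (m / (m + 1)) := by field_simp
      rw [this]
      have e : t / (2 * N / c) = (t * c / N) * (1 / 2) := by field_simp
      rw [e]
      refine mul_le_mul_of_nonneg_left ?_ (by positivity)
      rw [div_le_div_iff₀ (by norm_num) (by positivity)]
      linarith
    rw [neg_div]; linarith
  gcongr
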